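/- For a system of n polynomial equations f_1 = 0, ..., f_n = 0 in n complex variables, where f_i has degree d_i, the number of isolated complex solutions (counted with multiplicity) is at most the product d_1 · d_2 · ... · d_n (the classical Bézout bound). -/

import Mathlib

lemma bz_lagrange {σ : Type*} (F : Finset (σ → ℂ)) (x : σ → ℂ) (hx : x ∉ F) :
    ∃ e : MvPolynomial σ ℂ, MvPolynomial.eval x e = 1 ∧ ∀ y ∈ F, MvPolynomial.eval y e = 0 := by
  classical
  induction F using Finset.induction_on with
  | empty => exact ⟨1, by simp, by simp⟩
  | insert a s ha ih =>
    simp only [Finset.mem_insert, not_or] at hx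
    obtain ⟨e, h1, h2⟩ := ih hx.2
    obtain ⟨i, hi⟩ := Function.ne_iff.1 hx.1
    refine ⟨e * (MvPolynomial.C (x i - a i)⁻¹ * (MvPolynomial.X i - MvPolynomial.C (a i))), ?_, ?_⟩
    · have : x i - a i ≠ 0 := sub_ne_zero.2 hi
      simp [h1, this]
    · intro y hy
      rcases Finset.mem_insert.1 hy with rfl | hy
      · simp
      · simp [h2 y hy]

lemma bz_height (N : ℕ) (x : Fin N → ℂ) :
    (N : ℕ∞) ≤ (MvPolynomial.vanishingIdeal ℂ {x}).height := by
  classical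
  let φ : ℕ → (MvPolynomial (Fin N) ℂ →ₐ[ℂ] MvPolynomial (Fin N) ℂ) := fun j =>
    MvPolynomial.aeval (fun i => if (i : ℕ) < j then MvPolynomial.C (x i) else MvPolynomial.X i)
  have hp : ∀ j, (RingHom.ker (φ j)).IsPrime := fun j => RingHom.ker_isPrime _
  have hcomp : ∀ j, (φ (j+1)).comp (φ j) = φ (j+1) := by
    intro j
    apply MvPolynomial.algHom_ext
    intro i
    simp only [φ, AlgHom.comp_apply, MvPolynomial.aeval_X]
    by_cases h : (i : ℕ) < j
    · have : (i : ℕ) < j + 1 := by omega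
      simp [h, this]
    · simp [h]
  have key : ∀ j, j ≤ N → (j : ℕ∞) ≤ (RingHom.ker (φ j)).height := by
    intro j
    induction j with
    | zero => simp
    | succ j ih =>
      intro hj
      have h1 := ih (by omega)
      have hlt : RingHom.ker (φ j) < RingHom.ker (φ (j+1)) := by
        refine lt_of_le_of_ne ?_ ?_
        · intro p hp
          rw [RingHom.mem_ker] at hp ⊢
          rw [← hcomp j, AlgHom.comp_apply, hp, map_zero]
        · intro h
          let i : Fin N := ⟨j, by omega⟩
          have hm : (MvPolynomial.X i - MvPolynomial.C (x i) : MvPolynomial (Fin N) ℂ) ∈ RingHom.ker (φ (j+1)) := by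
            rw [RingHom.mem_ker, map_sub]
            simp only [φ, MvPolynomial.aeval_X]
            simp [i]
          rw [← h, RingHom.mem_ker, map_sub] at hm
          simp only [φ, MvPolynomial.aeval_X] at hm
          have := congrArg (MvPolynomial.eval (fun k => x k + 1)) hm
          simp [i, MvPolynomial.algebraMap_eq] at this
      have := hp j
      have := hp (j+1)
      have h2 := Ideal.height_add_one_le_of_lt_of_isPrime hlt
      push_cast
      exact le_trans (by gcongr) h2
  have hfin := key N le_rfl
  convert hfin using 2
  ext p
  rw [MvPolynomial.mem_vanishingIdeal_singleton_iff, RingHom.mem_ker]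
  have : φ N p = MvPolynomial.C (MvPolynomial.aeval x p) := by
    have : φ N = (Algebra.ofId ℂ _).comp (MvPolynomial.aeval x) := by
      apply MvPolynomial.algHom_ext
      intro i
      simp [φ, Algebra.ofId_apply]
    rw [this]; rfl
  rw [this]
  simp

lemma bz_small_root (p : Polynomial ℂ) (hp : p.Monic) (hd : p.natDegree ≠ 0) :
    ∃ z, p.IsRoot z ∧ ‖z‖ ^ p.natDegree ≤ ‖p.coeff 0‖ := by
  have hs := IsAlgClosed.splits p
  have hc : p.roots.card = p.natDegree := hs.natDegree_eq_card_roots.symm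
  by_contra! hcon
  have hprod := hs.coeff_zero_eq_prod_roots_of_monic hp
  have hn : ‖p.coeff 0‖ = (p.roots.map (fun z => ‖z‖)).prod := by
    rw [hprod, norm_mul, norm_pow, norm_neg, norm_one, one_pow, one_mul]
    exact map_multiset_prod (normHom : ℂ →*₀ ℝ) _ |>.trans rfl
  have hne : p.roots.toFinset.Nonempty := by
    rw [Finset.nonempty_iff_ne_empty, Ne, Multiset.toFinset_eq_empty]
    intro h; rw [h] at hc; exact hd (by simpa using hc.symm)
  obtain ⟨z, hz, hmin⟩ := p.roots.toFinset.exists_min_image (fun z => ‖z‖) hne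
  rw [Multiset.mem_toFinset] at hz
  have h2 := hcon z (Polynomial.isRoot_of_mem_roots hz)
  have : ∀ s : Multiset ℂ, (∀ w ∈ s, ‖z‖ ≤ ‖w‖) → ‖z‖ ^ s.card ≤ (s.map (fun z => ‖z‖)).prod := by
    intro s
    induction s using Multiset.induction_on with
    | empty => simp
    | cons a s ih =>
      intro h
      rw [Multiset.card_cons, pow_succ', Multiset.map_cons, Multiset.prod_cons]
      have h3 := h a (by simp)
      have h4 := ih (fun w hw => h w (by simp [hw]))
      gcongr
  have h5 := this p.roots (fun w hw => hmin w (by simpa using hw))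
  rw [hc, ← hn] at h5
  linarith

lemma bz_root_bound (p : Polynomial ℂ) (hp : p.Monic) (z : ℂ) (hz : p.IsRoot z) :
    ‖z‖ ≤ 1 + ∑ i ∈ Finset.range p.natDegree, ‖p.coeff i‖ := by
  have h := Polynomial.IsRoot.norm_lt_cauchyBound hp.ne_zero hz
  have h2 : p.cauchyBound ≤ 1 + ∑ i ∈ Finset.range p.natDegree, ‖p.coeff i‖₊ := by
    rw [Polynomial.cauchyBound, hp.leadingCoeff, nnnorm_one, div_one, add_comm]
    gcongr
    apply Finset.sup_le
    intro i hi
    exact Finset.single_le_sum (f := fun i => ‖p.coeff i‖₊) (fun _ _ => bot_le) hi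
  have h3 := h.le.trans h2
  have h4 := NNReal.coe_le_coe.2 h3
  simpa using h4

lemma bz_lying {s : ℕ} {A : Type*} [CommRing A] [IsDomain A] [Algebra ℂ A] [Algebra.FiniteType ℂ A]
    [Algebra (MvPolynomial (Fin s) ℂ) A] [IsScalarTower ℂ (MvPolynomial (Fin s) ℂ) A]
    [FaithfulSMul (MvPolynomial (Fin s) ℂ) A]
    [Algebra.IsIntegral (MvPolynomial (Fin s) ℂ) A]
    (g : A) (u : Fin s → ℂ) (τ : ℂ)
    (hτ : ((minpoly (MvPolynomial (Fin s) ℂ) g).map (MvPolynomial.eval u)).IsRoot τ) :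
    ∃ χ : A →ₐ[ℂ] ℂ, (∀ r, χ (algebraMap (MvPolynomial (Fin s) ℂ) A r) = MvPolynomial.eval u r) ∧
      χ g = τ := by
  have htf : Module.IsTorsionFree (MvPolynomial (Fin s) ℂ) A := inferInstance
  set R := MvPolynomial (Fin s) ℂ
  let ev : Polynomial R →+* ℂ := Polynomial.eval₂RingHom (MvPolynomial.eval u) τ
  have hC : ∀ z : ℂ, MvPolynomial.eval u (MvPolynomial.C z : R) = z :=
    fun z => MvPolynomial.eval_C z
  have hsurj : Function.Surjective ev := fun z => ⟨Polynomial.C (MvPolynomial.C z), by simp [ev, hC]⟩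
  have hmax : (RingHom.ker ev).IsMaximal := RingHom.ker_isMaximal_of_surjective _ hsurj
  let : Algebra (Polynomial R) A := (Polynomial.aeval g : Polynomial R →ₐ[R] A).toRingHom.toAlgebra
  have hal : ∀ p : Polynomial R, algebraMap (Polynomial R) A p = Polynomial.aeval g p := fun p => rfl
  have : IsScalarTower R (Polynomial R) A := IsScalarTower.of_algebraMap_eq (fun r => by
    rw [hal]; simp)
  have : Algebra.IsIntegral (Polynomial R) A := Algebra.IsIntegral.tower_top R
  have hker : RingHom.ker (algebraMap (Polynomial R) A) ≤ RingHom.ker ev := by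
    intro p hp
    rw [RingHom.mem_ker, hal] at hp
    obtain ⟨q, rfl⟩ := minpoly.isIntegrallyClosed_dvd (Algebra.IsIntegral.isIntegral g) hp
    rw [RingHom.mem_ker, map_mul]
    have : ev (minpoly R g) = 0 := by
      rw [Polynomial.IsRoot, Polynomial.eval_map] at hτ
      exact hτ
    rw [this, zero_mul]
  obtain ⟨M, hM, hMc⟩ := Ideal.exists_ideal_over_prime_of_isIntegral_of_isDomain (S := A) (RingHom.ker ev) hker
  have hMm : M.IsMaximal := Ideal.isMaximal_of_isIntegral_of_isMaximal_comap (R := Polynomial R) M (by rw [hMc]; exact hmax)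
  let := Ideal.Quotient.field M
  have : Algebra.FiniteType ℂ (A ⧸ M) := inferInstance
  have : Module.Finite ℂ (A ⧸ M) := finite_of_finite_type_of_isJacobsonRing ℂ (A ⧸ M)
  have hb : Function.Bijective (algebraMap ℂ (A ⧸ M)) := IsAlgClosed.algebraMap_bijective_of_isIntegral
  let e : ℂ ≃ₐ[ℂ] (A ⧸ M) := AlgEquiv.ofBijective (Algebra.ofId ℂ _) hb
  let χ : A →ₐ[ℂ] ℂ := e.symm.toAlgHom.comp (Ideal.Quotient.mkₐ ℂ M)
  have hχM : ∀ a ∈ M, χ a = 0 := by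
    intro a ha
    have : Ideal.Quotient.mkₐ ℂ M a = 0 := Ideal.Quotient.eq_zero_iff_mem.2 ha
    show e.symm (Ideal.Quotient.mkₐ ℂ M a) = 0
    rw [this, map_zero]
  have hχ : ∀ p : Polynomial R, χ (Polynomial.aeval g p) = ev p := by
    intro p
    have h1 : p - Polynomial.C (MvPolynomial.C (ev p)) ∈ RingHom.ker ev := by
      rw [RingHom.mem_ker, map_sub]; simp [ev, hC]
    rw [← hMc, Ideal.mem_comap] at h1
    have h2 := hχM _ h1
    rw [hal, map_sub, map_sub, sub_eq_zero] at h2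
    rw [h2, Polynomial.aeval_C]
    have : algebraMap R A (MvPolynomial.C (ev p)) = algebraMap ℂ A (ev p) :=
      (IsScalarTower.algebraMap_apply ℂ R A (ev p)).symm
    rw [this, AlgHom.commutes]
    rfl
  refine ⟨χ, fun r => ?_, ?_⟩
  · have := hχ (Polynomial.C r)
    rw [Polynomial.aeval_C] at this
    rw [this]; simp [ev]
  · have := hχ Polynomial.X
    rw [Polynomial.aeval_X] at this
    rw [this]; simp [ev]

lemma bz_prime {N : ℕ} (Q : Ideal (MvPolynomial (Fin N) ℂ)) (hQp : Q.IsPrime)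
    (hQ : ¬ Q.IsMaximal) (x0 : Fin N → ℂ) (hx0 : ∀ p ∈ Q, MvPolynomial.eval x0 p = 0)
    (U : Set (Fin N → ℂ)) (hU : U ∈ nhds x0) :
    ∃ y ∈ U, y ≠ x0 ∧ ∀ p ∈ Q, MvPolynomial.eval y p = 0 := by
  classical
  let A := MvPolynomial (Fin N) ℂ ⧸ Q
  obtain ⟨s, φ, hinj, hint⟩ := exists_integral_inj_algHom_of_fg ℂ (MvPolynomial (Fin N) ℂ ⧸ Q)
  let _ : Algebra (MvPolynomial (Fin s) ℂ) (MvPolynomial (Fin N) ℂ ⧸ Q) := φ.toRingHom.toAlgebra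
  have hal : ∀ r, algebraMap (MvPolynomial (Fin s) ℂ) (MvPolynomial (Fin N) ℂ ⧸ Q) r = φ r :=
    fun r => rfl
  have : IsScalarTower ℂ (MvPolynomial (Fin s) ℂ) (MvPolynomial (Fin N) ℂ ⧸ Q) :=
    IsScalarTower.of_algebraMap_eq (fun r => by
      rw [hal, MvPolynomial.algebraMap_eq, ← MvPolynomial.algebraMap_eq, AlgHom.commutes])
  have hI : Algebra.IsIntegral (MvPolynomial (Fin s) ℂ) (MvPolynomial (Fin N) ℂ ⧸ Q) := ⟨hint⟩
  have : FaithfulSMul (MvPolynomial (Fin s) ℂ) (MvPolynomial (Fin N) ℂ ⧸ Q) :=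
    (faithfulSMul_iff_algebraMap_injective _ _).2 hinj
  -- s is positive
  have hs : 0 < s := by
    rcases Nat.eq_zero_or_pos s with rfl | h
    · exfalso
      apply hQ
      have h1 : IsField (MvPolynomial (Fin 0) ℂ) :=
        (MvPolynomial.isEmptyAlgEquiv ℂ (Fin 0)).toMulEquiv.isField (Field.toIsField ℂ)
      have h2 : IsField (MvPolynomial (Fin N) ℂ ⧸ Q) := isField_of_isIntegral_of_isField' h1
      exact Ideal.Quotient.maximal_of_isField _ h2
    · exact h
  let i0 : Fin s := ⟨0, hs⟩
  -- lifts
  have hlift : ∀ j : Fin s, ∃ F : MvPolynomial (Fin N) ℂ,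
      Ideal.Quotient.mk Q F = φ (MvPolynomial.X j) := fun j => Ideal.Quotient.mk_surjective _
  choose F hF using hlift
  let ev : ∀ y : Fin N → ℂ, (∀ p ∈ Q, MvPolynomial.eval y p = 0) →
      ((MvPolynomial (Fin N) ℂ ⧸ Q) →ₐ[ℂ] ℂ) := fun y hy =>
    Ideal.Quotient.liftₐ Q (MvPolynomial.aeval y) (fun p hp => by
      rw [← MvPolynomial.coe_aeval_eq_eval] at hy; exact hy p hp)
  have hev : ∀ y hy p, ev y hy (Ideal.Quotient.mk Q p) = MvPolynomial.eval y p := by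
    intro y hy p
    rw [← MvPolynomial.coe_aeval_eq_eval]
    rfl
  let u0 : Fin s → ℂ := fun j => MvPolynomial.eval x0 (F j)
  -- a point over u: characters restricted to R
  have hres : ∀ (χ : (MvPolynomial (Fin N) ℂ ⧸ Q) →ₐ[ℂ] ℂ) (u : Fin s → ℂ),
      (∀ j, χ (φ (MvPolynomial.X j)) = u j) → ∀ r, χ (φ r) = MvPolynomial.eval u r := by
    intro χ u h r
    have : χ.comp φ = MvPolynomial.aeval u := by
      apply MvPolynomial.algHom_ext
      intro j
      simp [h]
    have h2 := DFunLike.congr_fun this r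
    rw [← MvPolynomial.coe_aeval_eq_eval]
    exact h2
  have hroot : ∀ (a : MvPolynomial (Fin N) ℂ ⧸ Q) (χ : (MvPolynomial (Fin N) ℂ ⧸ Q) →ₐ[ℂ] ℂ)
      (u : Fin s → ℂ), (∀ r, χ (φ r) = MvPolynomial.eval u r) →
      ((minpoly (MvPolynomial (Fin s) ℂ) a).map (MvPolynomial.eval u)).IsRoot (χ a) := by
    intro a χ u h
    have h1 := congrArg χ (minpoly.aeval (MvPolynomial (Fin s) ℂ) a)
    rw [map_zero, Polynomial.aeval_def] at h1
    have h2 : χ.toRingHom.comp (algebraMap (MvPolynomial (Fin s) ℂ) (MvPolynomial (Fin N) ℂ ⧸ Q))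
        = MvPolynomial.eval u := RingHom.ext h
    have h3 := Polynomial.hom_eval₂ (minpoly (MvPolynomial (Fin s) ℂ) a)
      (algebraMap (MvPolynomial (Fin s) ℂ) (MvPolynomial (Fin N) ℂ ⧸ Q)) χ.toRingHom a
    rw [h2] at h3
    rw [Polynomial.IsRoot, Polynomial.eval_map]
    exact h3.symm.trans h1
  have hmonic : ∀ a : MvPolynomial (Fin N) ℂ ⧸ Q, (minpoly (MvPolynomial (Fin s) ℂ) a).Monic :=
    fun a => minpoly.monic (hI.isIntegral a)
  -- fiber over u0 is finite
  let Φ : Set (Fin N → ℂ) := {y | (∀ p ∈ Q, MvPolynomial.eval y p = 0) ∧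
    ∀ j, MvPolynomial.eval y (F j) = u0 j}
  have hΦ : Φ.Finite := by
    refine (Set.Finite.pi (t := fun i : Fin N =>
      {z : ℂ | ((minpoly (MvPolynomial (Fin s) ℂ)
        (Ideal.Quotient.mk Q (MvPolynomial.X i))).map (MvPolynomial.eval u0)).IsRoot z})
      (fun i => Polynomial.finite_setOfPred_isRoot ((hmonic _).map _).ne_zero)).subset ?_
    rintro y ⟨hy1, hy2⟩ i -
    have h := hroot (Ideal.Quotient.mk Q (MvPolynomial.X i)) (ev y hy1) u0
      (hres _ _ (fun j => by rw [← hF, hev y hy1, hy2]))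
    rw [hev y hy1, MvPolynomial.eval_X] at h
    exact h
  obtain ⟨e, he1, he2⟩ := bz_lagrange (hΦ.toFinset.erase x0) x0 (by simp)
  let g : MvPolynomial (Fin N) ℂ := 1 - e
  let ga : MvPolynomial (Fin N) ℂ ⧸ Q := Ideal.Quotient.mk Q g
  let G := minpoly (MvPolynomial (Fin s) ℂ) ga
  have hGm : G.Monic := hmonic _
  have hGd : G.natDegree ≠ 0 := (minpoly.natDegree_pos (hI.isIntegral ga)).ne'
  -- sequence in base
  let u : ℕ → Fin s → ℂ := fun k => u0 + Pi.single i0 (1 / ((k : ℂ) + 1))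
  have hu : Filter.Tendsto u Filter.atTop (nhds u0) := by
    have h1 : Filter.Tendsto (fun k : ℕ => (1 / ((k : ℂ) + 1))) Filter.atTop (nhds 0) :=
      tendsto_one_div_add_atTop_nhds_zero_nat
    have h2 : Filter.Tendsto u Filter.atTop (nhds (u0 + Pi.single i0 0)) := by
      refine tendsto_const_nhds.add ?_
      exact ((continuous_single i0).tendsto 0).comp h1
    simpa using h2
  have hcont : ∀ {m : ℕ} (r : MvPolynomial (Fin m) ℂ), Continuous (fun v => MvPolynomial.eval v r) :=
    fun r => MvPolynomial.continuous_eval r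
  have hτ : ∀ k, ∃ τ, (G.map (MvPolynomial.eval (u k))).IsRoot τ ∧
      ‖τ‖ ^ G.natDegree ≤ ‖MvPolynomial.eval (u k) (G.coeff 0)‖ := by
    intro k
    have hn := hGm.natDegree_map (MvPolynomial.eval (u k))
    obtain ⟨τ, h1, h2⟩ := bz_small_root (G.map (MvPolynomial.eval (u k))) (hGm.map _)
      (by rw [hn]; exact hGd)
    rw [hn, Polynomial.coeff_map] at h2
    exact ⟨τ, h1, h2⟩
  choose τ hτ1 hτ2 using hτ
  have hG0 : MvPolynomial.eval u0 (G.coeff 0) = 0 := by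
    have h := hroot ga (ev x0 hx0) u0 (hres _ _ (fun j => by rw [← hF, hev x0 hx0]))
    rw [hev x0 hx0] at h
    have h0 : MvPolynomial.eval x0 g = 0 := by simp [g, he1]
    rw [h0, Polynomial.IsRoot, ← Polynomial.coeff_zero_eq_eval_zero, Polynomial.coeff_map] at h
    exact h
  have hτlim : Filter.Tendsto τ Filter.atTop (nhds 0) := by
    have h1 : Filter.Tendsto (fun k => ‖MvPolynomial.eval (u k) (G.coeff 0)‖) Filter.atTop (nhds 0) := by
      have h := (((hcont (G.coeff 0)).tendsto u0).comp hu).norm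
      rw [hG0, norm_zero] at h
      exact h
    rw [Metric.tendsto_atTop]
    intro ε hε
    obtain ⟨K, hK⟩ := Filter.eventually_atTop.1 (h1.eventually (gt_mem_nhds (pow_pos hε G.natDegree)))
    refine ⟨K, fun k hk => ?_⟩
    rw [dist_zero_right]
    exact lt_of_pow_lt_pow_left₀ _ hε.le ((hτ2 k).trans_lt (hK k hk))
  have hχ := fun k => bz_lying ga (u k) (τ k) (hτ1 k)
  choose χ hχ1 hχ2 using hχ
  let y : ℕ → Fin N → ℂ := fun k i => χ k (Ideal.Quotient.mk Q (MvPolynomial.X i))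
  have hy : ∀ k p, χ k (Ideal.Quotient.mk Q p) = MvPolynomial.eval (y k) p := by
    intro k p
    have : (χ k).comp (Ideal.Quotient.mkₐ ℂ Q) = MvPolynomial.aeval (y k) := by
      apply MvPolynomial.algHom_ext
      intro j
      simp [y]
    have h2 := DFunLike.congr_fun this p
    rw [← MvPolynomial.coe_aeval_eq_eval]
    exact h2
  have hyQ : ∀ k, ∀ p ∈ Q, MvPolynomial.eval (y k) p = 0 := by
    intro k p hp
    rw [← hy, Ideal.Quotient.eq_zero_iff_mem.2 hp, map_zero]
  have hyF : ∀ k j, MvPolynomial.eval (y k) (F j) = u k j := by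
    intro k j
    rw [← hy, hF, ← hal, hχ1, MvPolynomial.eval_X]
  -- boundedness
  have hbd : ∀ i, ∃ B : ℝ, ∀ k, ‖y k i‖ ≤ B := by
    intro i
    let p := minpoly (MvPolynomial (Fin s) ℂ) (Ideal.Quotient.mk Q (MvPolynomial.X i))
    have hpm : p.Monic := hmonic _
    have h1 : Filter.Tendsto (fun k => 1 + ∑ l ∈ Finset.range p.natDegree,
        ‖MvPolynomial.eval (u k) (p.coeff l)‖) Filter.atTop
        (nhds (1 + ∑ l ∈ Finset.range p.natDegree, ‖MvPolynomial.eval u0 (p.coeff l)‖)) := by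
      refine tendsto_const_nhds.add (tendsto_finsetSum _ fun l _ => ?_)
      exact (((hcont (p.coeff l)).tendsto u0).comp hu).norm
    obtain ⟨B, hB⟩ := h1.bddAbove_range
    refine ⟨B, fun k => le_trans ?_ (hB ⟨k, rfl⟩)⟩
    have h2 := bz_root_bound _ (hpm.map (MvPolynomial.eval (u k))) _
      (hroot (Ideal.Quotient.mk Q (MvPolynomial.X i)) (χ k) (u k) (hχ1 k))
    rw [hpm.natDegree_map] at h2
    simpa only [Polynomial.coeff_map] using h2
  choose B hB using hbd
  have hcomp : IsCompact (Set.univ.pi fun i : Fin N => Metric.closedBall (0 : ℂ) (B i)) :=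
    isCompact_univ_pi fun i => isCompact_closedBall _ _
  obtain ⟨a, -, ψ, hψ, hlim⟩ := hcomp.tendsto_subseq (x := y) (fun k i _ => by
    simpa using hB i k)
  have hlimp : ∀ p : MvPolynomial (Fin N) ℂ, Filter.Tendsto (fun k => MvPolynomial.eval (y (ψ k)) p)
      Filter.atTop (nhds (MvPolynomial.eval a p)) := fun p => ((hcont p).tendsto a).comp hlim
  have haQ : ∀ p ∈ Q, MvPolynomial.eval a p = 0 := by
    intro p hp
    refine tendsto_nhds_unique (hlimp p) ?_
    simp only [hyQ _ p hp]
    exact tendsto_const_nhds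
  have haF : ∀ j, MvPolynomial.eval a (F j) = u0 j := by
    intro j
    refine tendsto_nhds_unique (hlimp (F j)) ?_
    simp only [hyF]
    exact (tendsto_pi_nhds.1 hu j).comp hψ.tendsto_atTop
  have hag : MvPolynomial.eval a g = 0 := by
    refine tendsto_nhds_unique (hlimp g) ?_
    simp only [← hy]
    have : ∀ k, χ (ψ k) (Ideal.Quotient.mk Q g) = τ (ψ k) := fun k => hχ2 _
    simp only [this]
    exact hτlim.comp hψ.tendsto_atTop
  have hax : a = x0 := by
    by_contra hne
    have h := he2 a (by simp [hne]; exact ⟨haQ, haF⟩)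
    simp [g, h] at hag
  rw [hax] at hlim
  obtain ⟨k, hk⟩ := (hlim.eventually hU).exists
  refine ⟨y (ψ k), hk, ?_, hyQ _⟩
  intro h
  have h1 := hyF (ψ k) i0
  rw [h] at h1
  have h2 : u0 i0 = u (ψ k) i0 := h1
  simp only [u, Pi.add_apply, Pi.single_eq_same, left_eq_add] at h2
  have h3 : ((ψ k : ℂ) + 1) ≠ 0 := Nat.cast_add_one_ne_zero _
  exact one_div_ne_zero h3 h2

lemma bz_nonisolated (n : ℕ) (h : Fin n → MvPolynomial (Fin (n+1)) ℂ) (x0 : Fin (n+1) → ℂ)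
    (hx0 : ∀ i, MvPolynomial.eval x0 (h i) = 0) (U : Set (Fin (n+1) → ℂ)) (hU : U ∈ nhds x0) :
    ∃ y ∈ U, y ≠ x0 ∧ ∀ i, MvPolynomial.eval y (h i) = 0 := by
  have hm : (MvPolynomial.vanishingIdeal ℂ {x0}).IsMaximal :=
    MvPolynomial.isMaximal_iff_eq_vanishingIdeal_singleton.2 ⟨x0, rfl⟩
  have hmem : ∀ p, p ∈ MvPolynomial.vanishingIdeal ℂ {x0} ↔ MvPolynomial.eval x0 p = 0 := by
    intro p
    rw [MvPolynomial.mem_vanishingIdeal_singleton_iff, ← MvPolynomial.coe_aeval_eq_eval]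
    rfl
  have hle : Ideal.span (Set.range h) ≤ MvPolynomial.vanishingIdeal ℂ {x0} := by
    rw [Ideal.span_le]
    rintro _ ⟨i, rfl⟩
    exact (hmem _).2 (hx0 i)
  have hprime := hm.isPrime
  obtain ⟨Q, hQ, hQle⟩ := Ideal.exists_minimalPrimes_le hle
  have hne : Q ≠ MvPolynomial.vanishingIdeal ℂ {x0} := by
    rintro rfl
    have h1 := Ideal.height_le_card_of_mem_minimalPrimes_span (Set.finite_range h) hQ
    have h2 := (bz_height (n+1) x0).trans h1
    have h3 : (Set.range h).ncard ≤ n := by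
      rw [← Set.image_univ]
      refine (Set.ncard_image_le Set.finite_univ).trans ?_
      simp
    have h4 : n + 1 ≤ (Set.range h).ncard := by exact_mod_cast h2
    omega
  have hnm : ¬ Q.IsMaximal := fun hmax => hne (hmax.eq_of_le hprime.ne_top hQle)
  obtain ⟨y, hy1, hy2, hy3⟩ := bz_prime Q hQ.1.1 hnm x0 (fun p hp => (hmem p).1 (hQle hp)) U hU
  exact ⟨y, hy1, hy2, fun i => hy3 _ (hQ.1.2 (Ideal.subset_span ⟨i, rfl⟩))⟩

lemma bz_pigeon {n : ℕ} (f : Fin n → MvPolynomial (Fin n) ℂ) (d : Fin n → ℕ)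
    (hd : ∀ i, (f i).totalDegree ≤ d i) {B : Type*} [CommRing B] [Algebra ℂ B]
    (θ : MvPolynomial (Fin n) ℂ →ₐ[ℂ] B) (t : B)
    (hrel : ∀ i, θ (f i) + t * θ (MvPolynomial.X i) ^ d i = 0)
    {T : Type*} [Fintype T] (hT : ∏ i, d i < Fintype.card T) (e : T → MvPolynomial (Fin n) ℂ) :
    ∃ L : ℕ, ∃ c : T × Fin (L+1) → ℂ, c ≠ 0 ∧ ∑ a, c a • (t ^ (a.2 : ℕ) * θ (e a.1)) = 0 := by
  classical
  let m : ℕ := ∑ a, (e a).totalDegree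
  let W := MvPolynomial.restrictTotalDegree (Fin n) ℂ m
  have hW : ∀ p, p ∈ W ↔ p.totalDegree ≤ m := fun p => MvPolynomial.mem_restrictTotalDegree _ _ _
  have heW : ∀ a, e a ∈ W := fun a => (hW _).2
    (Finset.single_le_sum (f := fun a => (e a).totalDegree) (fun _ _ => Nat.zero_le _) (Finset.mem_univ a))
  let mon : (∀ i, Fin (d i)) → MvPolynomial (Fin n) ℂ := fun a =>
    MvPolynomial.monomial (Finsupp.equivFunOnFinite.symm fun i => (a i : ℕ)) 1
  let gen : ∀ j : ℕ, (∀ i, Fin (d i)) × Fin (j+1) → B := fun j a => t ^ (a.2 : ℕ) * θ (mon a.1)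
  let E : ℕ → Submodule ℂ B := fun j =>
    Submodule.span ℂ (Set.range (gen j)) ⊔ W.map θ.toLinearMap
  have hWE : ∀ j w, w ∈ W → θ w ∈ E j := fun j w hw =>
    (le_sup_right : W.map θ.toLinearMap ≤ E j) ⟨w, hw, rfl⟩
  have hgE : ∀ j (k : ℕ) (a : ∀ i, Fin (d i)), k ≤ j → t ^ k * θ (mon a) ∈ E j := fun j k a hk =>
    (le_sup_left : _ ≤ E j) (Submodule.subset_span ⟨(a, ⟨k, by omega⟩), rfl⟩)
  have hmono : ∀ j (b : Fin n →₀ ℕ), b.degree ≤ m → t * θ (MvPolynomial.monomial b 1) ∈ E (j+1) := by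
    intro j b hb
    by_cases h : ∃ i, d i ≤ b i
    · obtain ⟨i, hi⟩ := h
      have hsum : (b - Finsupp.single i (d i)) + Finsupp.single i (d i) = b := by
        apply tsub_add_cancel_of_le
        rw [Finsupp.single_le_iff]
        exact hi
      have hdeg : (b - Finsupp.single i (d i)).degree + d i = b.degree := by
        conv_rhs => rw [← hsum]
        rw [map_add, Finsupp.degree_single]
      have heq : t * θ (MvPolynomial.monomial b 1)
          = θ (-(MvPolynomial.monomial (b - Finsupp.single i (d i)) 1 * f i)) := by
        have h1 : (MvPolynomial.monomial b (1:ℂ)) =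
            MvPolynomial.monomial (b - Finsupp.single i (d i)) 1 * MvPolynomial.X i ^ d i := by
          rw [MvPolynomial.X_pow_eq_monomial, MvPolynomial.monomial_mul, hsum, one_mul]
        rw [h1, map_mul, map_pow, map_neg, map_mul]
        linear_combination θ (MvPolynomial.monomial (b - Finsupp.single i (d i)) 1) * hrel i
      rw [heq]
      apply hWE
      rw [hW, MvPolynomial.totalDegree_neg]
      refine (MvPolynomial.totalDegree_mul _ _).trans ?_
      have h2 : (MvPolynomial.monomial (b - Finsupp.single i (d i)) (1:ℂ)).totalDegree
          ≤ (b - Finsupp.single i (d i)).degree := MvPolynomial.totalDegree_monomial_le _ _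
      have := hd i
      omega
    · push Not at h
      have h1 := hgE (j+1) 1 (fun i => ⟨b i, h i⟩) (by omega)
      rw [pow_one] at h1
      have h2 : mon (fun i => ⟨b i, h i⟩) = MvPolynomial.monomial b 1 := by
        have h3 : (Finsupp.equivFunOnFinite.symm fun i => b i) = b := by ext i; rfl
        show MvPolynomial.monomial (Finsupp.equivFunOnFinite.symm fun i => b i) 1 = _
        rw [h3]
      rw [h2] at h1
      exact h1
  have hTW : ∀ j w, w ∈ W → t * θ w ∈ E (j+1) := by
    intro j w hw
    rw [MvPolynomial.as_sum w, map_sum, Finset.mul_sum]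
    refine Submodule.sum_mem _ fun b hb => ?_
    have h1 : MvPolynomial.monomial b (MvPolynomial.coeff b w)
        = MvPolynomial.coeff b w • MvPolynomial.monomial b (1:ℂ) := by
      rw [MvPolynomial.smul_monomial, smul_eq_mul, mul_one]
    rw [h1, map_smul, mul_smul_comm]
    refine Submodule.smul_mem _ _ (hmono j b ?_)
    exact (MvPolynomial.le_totalDegree hb).trans ((hW w).1 hw)
  have hTE : ∀ j, E j ≤ (E (j+1)).comap (LinearMap.mulLeft ℂ t) := by
    intro j
    refine sup_le ?_ ?_
    · rw [Submodule.span_le]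
      rintro _ ⟨⟨a, k⟩, rfl⟩
      show t * (t ^ (k : ℕ) * θ (mon a)) ∈ E (j+1)
      rw [← mul_assoc, ← pow_succ']
      exact hgE _ _ _ (by omega)
    · rintro _ ⟨w, hw, rfl⟩
      exact hTW j w hw
  have hEmono : ∀ j, E j ≤ E (j+1) := by
    intro j
    refine sup_le ?_ le_sup_right
    rw [Submodule.span_le]
    rintro _ ⟨⟨a, k⟩, rfl⟩
    exact hgE _ _ _ (by omega)
  have hE : Monotone E := monotone_nat_of_le_succ hEmono
  have hpow : ∀ j w, w ∈ W → t ^ j * θ w ∈ E j := by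
    intro j
    induction j with
    | zero => intro w hw; simpa using hWE 0 w hw
    | succ j ih =>
      intro w hw
      have := hTE j (ih w hw)
      rw [pow_succ', mul_assoc]
      exact this
  let L := Module.finrank ℂ W
  have hspan : FiniteDimensional ℂ (Submodule.span ℂ (Set.range (gen L))) :=
    FiniteDimensional.span_of_finite ℂ (Set.finite_range _)
  have hfd : FiniteDimensional ℂ (E L) := inferInstance
  have hfr : Module.finrank ℂ (E L) ≤ (∏ i, d i) * (L+1) + L := by
    refine (Submodule.finrank_add_le_finrank_add_finrank _ _).trans ?_
    refine add_le_add ?_ (Submodule.finrank_map_le _ _)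
    refine (finrank_range_le_card (R := ℂ) (gen L)).trans ?_
    simp
  let Λ : (T × Fin (L+1) → ℂ) →ₗ[ℂ] E L := Fintype.linearCombination ℂ
    (fun a : T × Fin (L+1) => (⟨t ^ (a.2 : ℕ) * θ (e a.1),
      hE (by omega) (hpow a.2 (e a.1) (heW _))⟩ : E L))
  have hker : LinearMap.ker Λ ≠ ⊥ := by
    apply LinearMap.ker_ne_bot_of_finrank_lt
    refine hfr.trans_lt ?_
    simp only [Module.finrank_fintype_fun_eq_card, Fintype.card_prod, Fintype.card_fin]
    nlinarith
  obtain ⟨c, hc, hc0⟩ := Submodule.exists_mem_ne_zero_of_ne_bot hker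
  refine ⟨L, c, hc0, ?_⟩
  have h1 := congrArg (fun v : E L => (v : B)) (LinearMap.mem_ker.1 hc)
  simp only [Λ, Fintype.linearCombination_apply, Submodule.coe_sum, Submodule.coe_smul,
    Submodule.coe_zero] at h1
  exact h1

lemma bz_iso {n : ℕ} (f : Fin n → MvPolynomial (Fin n) ℂ) (d : Fin n → ℕ)
    (h : Fin n → MvPolynomial (Fin (n+1)) ℂ)
    (hh : ∀ i, h i = MvPolynomial.rename Fin.succ (f i) +
      MvPolynomial.X 0 * (MvPolynomial.rename Fin.succ (MvPolynomial.X i)) ^ d i)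
    (x : Fin n → ℂ) (hx : ∀ i, MvPolynomial.eval x (f i) = 0)
    (U : Set (Fin n → ℂ)) (hU : U ∈ nhds x)
    (hiso : ∀ y ∈ U, (∀ i, MvPolynomial.eval y (f i) = 0) → y = x)
    (q : MvPolynomial (Fin (n+1)) ℂ) (j : ℕ)
    (hq : MvPolynomial.X 0 ^ j * q ∈ Ideal.span (Set.range h)) :
    MvPolynomial.eval (Fin.cons 0 x : Fin (n+1) → ℂ) q = 0 := by
  by_contra hne
  have h0 : ∀ (z : Fin n → ℂ) i, MvPolynomial.eval (Fin.cons 0 z : Fin (n+1) → ℂ) (h i) =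
      MvPolynomial.eval z (f i) := by
    intro z i
    have : (Fin.cons 0 z : Fin (n+1) → ℂ) ∘ Fin.succ = z := by ext k; simp
    rw [hh, map_add, map_mul, MvPolynomial.eval_X, Fin.cons_zero, zero_mul, add_zero,
      MvPolynomial.eval_rename, this]
  have hV1 : {z : Fin (n+1) → ℂ | MvPolynomial.eval z q ≠ 0} ∈ nhds (Fin.cons 0 x : Fin (n+1) → ℂ) :=
    (MvPolynomial.continuous_eval q).continuousAt.eventually_ne hne
  have hV2 : {z : Fin (n+1) → ℂ | Fin.tail z ∈ U} ∈ nhds (Fin.cons 0 x : Fin (n+1) → ℂ) := by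
    have hc : Continuous (fun z : Fin (n+1) → ℂ => (Fin.tail z : Fin n → ℂ)) :=
      continuous_pi fun i => continuous_apply _
    refine hc.continuousAt.preimage_mem_nhds ?_
    rw [Fin.tail_cons]
    exact hU
  obtain ⟨z, ⟨hz1, hz2⟩, hz3, hz4⟩ := bz_nonisolated n h (Fin.cons 0 x)
    (fun i => by rw [h0, hx]) _ (Filter.inter_mem hV1 hV2)
  have hspan : Ideal.span (Set.range h) ≤ RingHom.ker (MvPolynomial.eval z) := by
    rw [Ideal.span_le]
    rintro _ ⟨i, rfl⟩
    exact hz4 i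
  have h1 := hspan hq
  rw [RingHom.mem_ker, map_mul, map_pow, MvPolynomial.eval_X] at h1
  have hz0 : z 0 = 0 := by
    rcases mul_eq_zero.1 h1 with h2 | h2
    · exact eq_zero_of_pow_eq_zero h2
    · exact absurd h2 hz1
  have hz : (Fin.cons 0 (Fin.tail z) : Fin (n+1) → ℂ) = z := by
    rw [← hz0]; exact Fin.cons_self_tail z
  have ht : Fin.tail z = x := hiso _ hz2 (fun i => by
    rw [← h0, hz]; exact hz4 i)
  exact hz3 (by rw [← hz, ht])

lemma bz_card {n : ℕ} (f : Fin n → MvPolynomial (Fin n) ℂ) (d : Fin n → ℕ)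
    (hd : ∀ i, (f i).totalDegree ≤ d i) (T : Finset (Fin n → ℂ))
    (hT : ∀ x ∈ T, (∀ i, MvPolynomial.eval x (f i) = 0) ∧ ∃ U ∈ nhds x,
      ∀ y ∈ U, (∀ i, MvPolynomial.eval y (f i) = 0) → y = x) :
    T.card ≤ ∏ i, d i := by
  classical
  by_contra! hcard
  have hlag := fun x : T => bz_lagrange (T.erase x) x (by simp)
  choose e he1 he2 using hlag
  let h : Fin n → MvPolynomial (Fin (n+1)) ℂ := fun i => MvPolynomial.rename Fin.succ (f i) +
      MvPolynomial.X 0 * (MvPolynomial.rename Fin.succ (MvPolynomial.X i)) ^ d i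
  let π := Ideal.Quotient.mkₐ ℂ (Ideal.span (Set.range h))
  have hπ : ∀ p, π p = 0 ↔ p ∈ Ideal.span (Set.range h) := fun p => Ideal.Quotient.eq_zero_iff_mem
  obtain ⟨L, c, hc0, hc⟩ := bz_pigeon f d hd (π.comp (MvPolynomial.rename Fin.succ))
    (π (MvPolynomial.X 0)) (fun i => by
      have h1 : π (h i) = 0 := (hπ _).2 (Ideal.subset_span ⟨i, rfl⟩)
      simpa only [h, map_add, map_mul, map_pow, AlgHom.comp_apply] using h1)
    (T := T) (by simpa using hcard) e
  have hex : ∃ j : ℕ, ∃ a : T × Fin (L+1), (a.2 : ℕ) = j ∧ c a ≠ 0 := by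
    obtain ⟨a, ha⟩ := Function.ne_iff.1 hc0
    exact ⟨a.2, a, rfl, ha⟩
  obtain ⟨⟨b, k0⟩, hb1, hb2⟩ := Nat.find_spec hex
  have hmin : ∀ a : T × Fin (L+1), (a.2 : ℕ) < Nat.find hex → c a = 0 := by
    intro a ha
    by_contra hne
    exact Nat.find_min hex ha ⟨a, rfl, hne⟩
  set j0 := Nat.find hex
  simp only at hb1
  let q : MvPolynomial (Fin (n+1)) ℂ := ∑ a : T × Fin (L+1),
    c a • (MvPolynomial.X 0 ^ ((a.2 : ℕ) - j0) * MvPolynomial.rename Fin.succ (e a.1))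
  have hq : MvPolynomial.X 0 ^ j0 * q ∈ Ideal.span (Set.range h) := by
    rw [← hπ, ← hc, Finset.mul_sum, map_sum]
    refine Finset.sum_congr rfl fun a _ => ?_
    by_cases ha : (a.2 : ℕ) < j0
    · simp [hmin a ha]
    · rw [mul_smul_comm, ← mul_assoc, ← pow_add, Nat.add_sub_cancel' (by omega), map_smul, map_mul,
        map_pow, AlgHom.comp_apply]
  obtain ⟨hx, U, hU, hiso⟩ := hT b b.2
  have h1 := bz_iso f d h (fun _ => rfl) b hx U hU hiso q j0 hq
  have hcomp : (Fin.cons 0 (b : Fin n → ℂ) : Fin (n+1) → ℂ) ∘ Fin.succ = b := by ext k; simp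
  rw [map_sum, Finset.sum_eq_single (b, k0)] at h1
  · rw [MvPolynomial.smul_eval, map_mul, MvPolynomial.eval_rename, hcomp, he1, map_pow] at h1
    simp [hb1] at h1
    exact hb2 h1
  · rintro ⟨a, k⟩ - hne
    rw [MvPolynomial.smul_eval, map_mul, MvPolynomial.eval_rename, hcomp, map_pow,
      MvPolynomial.eval_X, Fin.cons_zero]
    simp only
    by_cases hab : a = b
    · subst hab
      have hk : (k : ℕ) ≠ j0 := by
        intro hk
        apply hne
        rw [Prod.mk.injEq]
        exact ⟨rfl, Fin.ext (hk.trans hb1.symm)⟩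
      rcases lt_or_gt_of_ne hk with hlt | hgt
      · rw [hmin (a, k) hlt, zero_mul]
      · rw [zero_pow (by omega), zero_mul, mul_zero]
    · rw [he2 a b (by
        rw [Finset.mem_erase]
        exact ⟨fun h => hab (Subtype.ext h.symm), b.2⟩), mul_zero, mul_zero]
  · intro h; exact absurd (Finset.mem_univ _) h

/-- Classical Bézout bound: a system of `n` polynomial equations in `n` complex
variables, with `f i` a nonzero polynomial of degree `d i`, has at most
`∏ i, d i` isolated complex solutions. -/
theorem bezout_bound (n : ℕ) (f : Fin n → MvPolynomial (Fin n) ℂ)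
    (d : Fin n → ℕ) (hf : ∀ i, f i ≠ 0)
    (hd : ∀ i, (f i).totalDegree = d i) :
    let S : Set (Fin n → ℂ) := {x | ∀ i, MvPolynomial.eval x (f i) = 0}
    let I : Set (Fin n → ℂ) := {x ∈ S | ∃ U ∈ nhds x, ∀ y ∈ U, y ∈ S → y = x}
    I.Finite ∧ I.ncard ≤ ∏ i, d i := by
  intro S I
  have key : ∀ T : Finset (Fin n → ℂ), (T : Set (Fin n → ℂ)) ⊆ I → T.card ≤ ∏ i, d i := by
    intro T hT
    refine bz_card f d (fun i => (hd i).le) T (fun x hx => ?_)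
    obtain ⟨h1, U, hU, h2⟩ := hT hx
    exact ⟨h1, U, hU, h2⟩
  have henc : I.encard ≤ ((∏ i, d i : ℕ) : ℕ∞) := by
    by_contra! hlt
    obtain ⟨t, ht, htc⟩ := Set.exists_subset_encard_eq (Order.add_one_le_of_lt hlt)
    have htf : t.Finite := by
      rw [← Set.encard_lt_top_iff, htc]
      exact_mod_cast ENat.coe_lt_top _
    have h1 := key htf.toFinset (by simpa using ht)
    rw [htf.encard_eq_coe_toFinset_card] at htc
    have h2 : htf.toFinset.card = ∏ i, d i + 1 := by exact_mod_cast htc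
    omega
  have hfin : I.Finite := Set.finite_of_encard_le_coe henc
  refine ⟨hfin, ?_⟩
  rw [← hfin.cast_ncard_eq] at henc
  exact_mod_cast henc
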